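/- Let (R,Λ,S) be a generalised Renner–Coxeter system. Let e,f ∈ Λ and let w be an (λ(e), λ(f))-reduced element of the unit group W. Then there exists h ∈ Λ with h ≤ e·f such that e·w·f = h, w ∈ W_⋆(h) (i.e. wh = hw = h). -/

import Mathlib

noncomputable section

/-- A generalised Renner–Coxeter system on a monoid `R`: a Coxeter system `(Rˣ, S)` on the unit
group (indexed by `B`, with data `cm`, `cs`), a cross-section semilattice `Λ` of idempotents,
and type maps `lam = λ`, `lamStar = λ_⋆` satisfying axioms (ECS1)–(ECS6). -/
structure GRCSystem (B : Type*) (R : Type*) [Monoid R] where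
  /-- The Coxeter matrix indexing the simple reflections `S`. -/
  cm : CoxeterMatrix B
  /-- (ECS3): the unit group of `R` is a Coxeter group. -/
  cs : CoxeterSystem cm Rˣ
  /-- The cross-section lattice `Λ`. -/
  Λ : Set R
  /-- The type map `λ`, with `W(e) = W_{λ(e)}`. -/
  lam : R → Set B
  /-- The map `λ_⋆`, with `W_⋆(e) = W_{λ_⋆(e)}`. -/
  lamStar : R → Set B
  /-- (ECS1): idempotents commute, i.e. `E(R)` is a (lower) semilattice. -/
  idem_mul_comm : ∀ e f : R, IsIdempotentElem e → IsIdempotentElem f → e * f = f * e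
  /-- (ECS1): `R` is unit regular (factorisable). -/
  factor : ∀ r : R, ∃ (e : R) (g : Rˣ), IsIdempotentElem e ∧ r = e * (g : R)
  /-- (ECS2): elements of `Λ` are idempotent. -/
  lam_idem : ∀ e ∈ Λ, IsIdempotentElem e
  /-- (ECS2): `Λ` is a sub-semilattice of `E(R)`. -/
  lam_mul_mem : ∀ e ∈ Λ, ∀ f ∈ Λ, e * f ∈ Λ
  /-- (ECS2): `Λ` is a transversal of `E(R)` for the conjugation action of the unit group. -/
  transversal : ∀ e : R, IsIdempotentElem e →
    ∃! f : R, f ∈ Λ ∧ ∃ w : Rˣ, (w : R) * f * ((w⁻¹ : Rˣ) : R) = e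
  /-- (ECS4): comparable idempotents are simultaneously conjugate to a comparable pair in `Λ`. -/
  ecs4 : ∀ e₁ e₂ : R, IsIdempotentElem e₁ → IsIdempotentElem e₂ →
    e₁ * e₂ = e₁ → e₂ * e₁ = e₁ →
    ∃ (w : Rˣ) (f₁ f₂ : R), f₁ ∈ Λ ∧ f₂ ∈ Λ ∧ f₁ * f₂ = f₁ ∧ f₂ * f₁ = f₁ ∧
      (w : R) * f₁ * ((w⁻¹ : Rˣ) : R) = e₁ ∧ (w : R) * f₂ * ((w⁻¹ : Rˣ) : R) = e₂
  /-- (ECS5): `W(e)` is the standard parabolic subgroup on `λ(e)`. -/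
  mem_lam_iff : ∀ e ∈ Λ, ∀ w : Rˣ,
    ((w : R) * e = e * (w : R)) ↔ w ∈ Subgroup.closure (cs.simple '' lam e)
  /-- (ECS5): `W_⋆(e)` is the standard parabolic subgroup on `λ_⋆(e)`. -/
  mem_lamStar_iff : ∀ e ∈ Λ, ∀ w : Rˣ,
    ((w : R) * e = e ∧ e * (w : R) = e) ↔ w ∈ Subgroup.closure (cs.simple '' lamStar e)
  /-- (ECS6): the map `e ↦ λ^⋆(e)` is order preserving. -/
  ecs6 : ∀ e ∈ Λ, ∀ f ∈ Λ, e * f = e →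
    ∀ s : B, ((cs.simple s : R) * e = e * (cs.simple s : R) ∧ (cs.simple s : R) * e ≠ e) →
      ((cs.simple s : R) * f = f * (cs.simple s : R) ∧ (cs.simple s : R) * f ≠ f)

namespace GRCSystem

variable {B R : Type*} [Monoid R] (G : GRCSystem B R)

/-- The standard parabolic subgroup `W_I` of the unit group of `R`. -/
def parab (I : Set B) : Subgroup Rˣ := Subgroup.closure (G.cs.simple '' I)

/-- The set `λ^⋆(e) = {s ∈ S : s e = e s ≠ e}`. -/
def lamCostar (e : R) : Set B :=
  {s : B | (G.cs.simple s : R) * e = e * (G.cs.simple s : R) ∧ (G.cs.simple s : R) * e ≠ e}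

/-- Value in `R` of a letter of the alphabet `S ⊔ R`. -/
def letterVal : B ⊕ R → R := Sum.elim (fun s => ((G.cs.simple s : Rˣ) : R)) id

/-- A word on the alphabet `S ∪ (Λ ∖ {1})`: every `inr` letter is a nonidentity element of `Λ`. -/
def IsWord (l : List (B ⊕ R)) : Prop := ∀ e : R, Sum.inr e ∈ l → e ∈ G.Λ ∧ e ≠ 1

/-- The length of a word: letters from `S` count 1, letters from `Λ` count 0. -/
def wordLen (l : List (B ⊕ R)) : ℕ := (l.filter Sum.isLeft).length

/-- The length `ℓ(r)`: the minimal length of a word on `S ∪ (Λ ∖ {1})` representing `r`. -/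
def len (r : R) : ℕ :=
  sInf {n : ℕ | ∃ l : List (B ⊕ R), G.IsWord l ∧ (l.map G.letterVal).prod = r ∧ n = wordLen l}

/-- `(w₁, e, w₂)` is the normal decomposition of `r`: `e ∈ Λ`, `w₁` is `(∅, λ_⋆(e))`-reduced
(minimal length in `w₁ W_{λ_⋆(e)}`), `w₂` is `(λ(e), ∅)`-reduced (minimal length in
`W_{λ(e)} w₂`), and `r = w₁ e w₂`. -/
def IsNormalDecomp (r : R) (w₁ : Rˣ) (e : R) (w₂ : Rˣ) : Prop :=
  e ∈ G.Λ ∧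
  (∀ u ∈ G.parab (G.lamStar e), G.cs.length w₁ ≤ G.cs.length (w₁ * u)) ∧
  (∀ u ∈ G.parab (G.lam e), G.cs.length w₂ ≤ G.cs.length (u * w₂)) ∧
  r = (w₁ : R) * e * (w₂ : R)

/-- `w` is `(I,J)`-reduced: `w` has minimal length in the double coset `W_I w W_J`. -/
def IsRed (I J : Set B) (w : Rˣ) : Prop :=
  ∀ u ∈ G.parab I, ∀ v ∈ G.parab J, G.cs.length w ≤ G.cs.length (u * w * v)

end GRCSystem

namespace CoxeterSystem

variable {B W : Type*} [Group W] {M : CoxeterMatrix B} (cs : CoxeterSystem M W)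

open scoped Classical in
/-- The action of a simple reflection on pairs `(t, ε)`: conjugate `t`, and flip the sign `ε`
when `t` is that reflection. -/
def signedConj (i : B) : Function.End (W × ZMod 2) := fun p =>
  (cs.simple i * p.1 * cs.simple i, p.2 + if p.1 = cs.simple i then 1 else 0)

theorem simple_mul_pow_mul_simple (i j : B) (k : ℕ) :
    cs.simple j * (cs.simple i * cs.simple j) ^ k =
      ((cs.simple i * cs.simple j) ^ k)⁻¹ * cs.simple j := by
  have h : SemiconjBy (cs.simple j) (cs.simple i * cs.simple j)
      (cs.simple i * cs.simple j)⁻¹ := by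
    simp [SemiconjBy, mul_assoc]
  rw [(h.pow_right k).eq, inv_pow]

open scoped Classical in
theorem signedConj_mul_pow_apply (i j : B) (k : ℕ) (t : W) (ε : ZMod 2) :
    ((cs.signedConj i * cs.signedConj j) ^ k) (t, ε) =
      ((cs.simple i * cs.simple j) ^ k * t * ((cs.simple i * cs.simple j) ^ k)⁻¹,
        ε + ∑ l ∈ Finset.range (2 * k),
          if (cs.simple i * cs.simple j) ^ l * t = cs.simple j then 1 else 0) := by
  induction k with
  | zero => simp; rfl
  | succ k ih =>
    have key := cs.simple_mul_pow_mul_simple i j k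
    have hstep : ((cs.signedConj i * cs.signedConj j) ^ (k + 1)) (t, ε) =
        cs.signedConj i (cs.signedConj j (((cs.signedConj i * cs.signedConj j) ^ k) (t, ε))) := by
      rw [pow_succ']; rfl
    rw [hstep, ih]
    set x := cs.simple i * cs.simple j with hx
    have hj : x ^ k * t * (x ^ k)⁻¹ = cs.simple j ↔ x ^ (2 * k) * t = cs.simple j := by
      rw [mul_inv_eq_iff_eq_mul, key, eq_inv_mul_iff_mul_eq, ← mul_assoc, ← pow_add, ← two_mul]
    have hi : cs.simple j * (x ^ k * t * (x ^ k)⁻¹) * cs.simple j = cs.simple i ↔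
        x ^ (2 * k + 1) * t = cs.simple j := by
      have h1 : cs.simple j * (x ^ k * t * (x ^ k)⁻¹) * cs.simple j = cs.simple i ↔
          x * (x ^ k * t * (x ^ k)⁻¹) = cs.simple j := by
        constructor
        · intro h
          calc x * (x ^ k * t * (x ^ k)⁻¹)
              = cs.simple i * (cs.simple j * (x ^ k * t * (x ^ k)⁻¹) * cs.simple j)
                  * cs.simple j := by simp [hx, mul_assoc]
            _ = cs.simple j := by rw [h]; simp
        · intro h
          calc cs.simple j * (x ^ k * t * (x ^ k)⁻¹) * cs.simple j
              = cs.simple i * (x * (x ^ k * t * (x ^ k)⁻¹)) * cs.simple j := by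
                simp [hx, mul_assoc]
            _ = cs.simple i := by rw [h]; simp
      rw [h1, ← mul_assoc, mul_inv_eq_iff_eq_mul, key, eq_inv_mul_iff_mul_eq]
      have : x ^ (2 * k + 1) * t = x ^ k * (x * (x ^ k * t)) := by
        rw [two_mul, add_assoc, pow_add, pow_succ', mul_assoc, mul_assoc]
      rw [this]
    simp only [signedConj, hj, hi]
    ext
    · simp [pow_succ', hx, mul_assoc]
    · rw [mul_add, mul_one, Finset.sum_range_succ, Finset.sum_range_succ]
      ring

theorem isLiftable_signedConj : M.IsLiftable cs.signedConj := by
  classical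
  intro i j
  funext ⟨t, ε⟩
  rw [signedConj_mul_pow_apply, two_mul, Finset.sum_range_add]
  simp only [pow_add, cs.simple_mul_simple_pow, one_mul, CharTwo.add_self_eq_zero, inv_one,
    mul_one, add_zero]
  rfl

/-- The signed conjugation action of the Coxeter group. -/
def signedConjHom : W →* Function.End (W × ZMod 2) :=
  cs.lift ⟨cs.signedConj, cs.isLiftable_signedConj⟩

open scoped Classical in
theorem signedConjHom_wordProd_apply (ω : List B) (t : W) (ε : ZMod 2) :
    cs.signedConjHom (cs.wordProd ω) (t, ε) =
      (cs.wordProd ω * t * (cs.wordProd ω)⁻¹, ε + ((cs.rightInvSeq ω).count t : ZMod 2)) := by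
  induction ω with
  | nil => simp; rfl
  | cons i ω ih =>
    have hstep : cs.signedConjHom (cs.wordProd (i :: ω)) (t, ε) =
        cs.signedConj i (cs.signedConjHom (cs.wordProd ω) (t, ε)) := by
      rw [wordProd_cons, map_mul, signedConjHom, lift_apply_simple]; rfl
    have hiff : cs.wordProd ω * t * (cs.wordProd ω)⁻¹ = cs.simple i ↔
        (cs.wordProd ω)⁻¹ * cs.simple i * cs.wordProd ω = t := by
      rw [mul_inv_eq_iff_eq_mul, ← eq_inv_mul_iff_mul_eq, mul_assoc, eq_comm]
    rw [hstep, ih]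
    simp only [signedConj, hiff, rightInvSeq, List.count_cons, beq_iff_eq, wordProd_cons]
    ext
    · simp [mul_assoc]
    · push_cast
      ring

/-- The parity with which `t` occurs in the right inversion sequence of a word depends only on the
product of the word. -/
theorem count_rightInvSeq_eq [DecidableEq W] {ω ω' : List B}
    (h : cs.wordProd ω = cs.wordProd ω') (t : W) :
    ((cs.rightInvSeq ω).count t : ZMod 2) = (cs.rightInvSeq ω').count t := by
  have h1 := cs.signedConjHom_wordProd_apply ω t 0
  rw [h, cs.signedConjHom_wordProd_apply ω' t 0] at h1
  have h2 := congrArg Prod.snd h1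
  simp only [zero_add] at h2
  convert h2.symm

theorem IsRightDescent.mem_rightInvSeq {cs : CoxeterSystem M W} {ω : List B} {i : B}
    (h : cs.IsRightDescent (cs.wordProd ω) i) : cs.simple i ∈ cs.rightInvSeq ω := by
  classical
  obtain ⟨ω', hω', hprod⟩ := cs.exists_isReduced (cs.wordProd ω * cs.simple i)
  have hword : cs.wordProd (ω'.concat i) = cs.wordProd ω := by
    rw [wordProd_concat, ← hprod, simple_mul_simple_cancel_right]
  have hred : cs.IsReduced (ω'.concat i) := by
    rw [isRightDescent_iff, hprod, hω'] at h
    rw [IsReduced, hword, ← h, List.length_concat]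
  have hcount : (cs.rightInvSeq (ω'.concat i)).count (cs.simple i) = 1 :=
    List.count_eq_one_of_mem hred.nodup_rightInvSeq (by rw [rightInvSeq_concat]; simp)
  have hpar := cs.count_rightInvSeq_eq hword (cs.simple i)
  by_contra hmem
  rw [hcount, List.count_eq_zero_of_not_mem hmem] at hpar
  simp at hpar

/-- The exchange property. -/
theorem IsRightDescent.exists_eraseIdx {cs : CoxeterSystem M W} {ω : List B} {i : B}
    (h : cs.IsRightDescent (cs.wordProd ω) i) :
    ∃ j < ω.length, cs.wordProd ω * cs.simple i = cs.wordProd (ω.eraseIdx j) := by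
  obtain ⟨j, hj, hji⟩ := List.mem_iff_getElem.mp h.mem_rightInvSeq
  refine ⟨j, by simpa using hj, ?_⟩
  rw [← cs.wordProd_mul_getD_rightInvSeq, List.getD_eq_getElem _ _ hj, hji]

/-- The deletion property: every word contains a reduced word with the same product. -/
theorem exists_isReduced_sublist (ω : List B) :
    ∃ ω', ω'.Sublist ω ∧ cs.IsReduced ω' ∧ cs.wordProd ω' = cs.wordProd ω := by
  induction ω using List.reverseRecOn with
  | nil => exact ⟨[], List.Sublist.refl _, by simp [IsReduced], rfl⟩
  | append_singleton ω i ih =>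
    obtain ⟨ω', hsub, hred, hprod⟩ := ih
    by_cases h : cs.IsRightDescent (cs.wordProd ω') i
    · obtain ⟨j, hj, hji⟩ := h.exists_eraseIdx
      refine ⟨ω'.eraseIdx j, ((List.eraseIdx_sublist _ _).trans hsub).trans
        (List.sublist_append_left _ _), ?_, ?_⟩
      · rw [isRightDescent_iff, hji, hred] at h
        have := List.length_eraseIdx_add_one hj
        rw [IsReduced]
        lia
      · rw [← hji, hprod, wordProd_append, wordProd_singleton]
    · refine ⟨ω' ++ [i], hsub.append (List.Sublist.refl _), ?_, ?_⟩
      · rw [not_isRightDescent_iff, hred] at h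
        rw [IsReduced, wordProd_append, wordProd_singleton, h]
        simp
      · rw [wordProd_append, wordProd_append, hprod]

theorem mem_closure_simple_image_iff {I : Set B} {w : W} :
    w ∈ Subgroup.closure (cs.simple '' I) ↔ ∃ ω : List B, (∀ i ∈ ω, i ∈ I) ∧ cs.wordProd ω = w := by
  constructor
  · intro h
    induction h using Subgroup.closure_induction with
    | mem x hx =>
      obtain ⟨i, hi, rfl⟩ := hx
      exact ⟨[i], by simpa using hi, by simp⟩
    | one => exact ⟨[], by simp, by simp⟩
    | mul x y _ _ hx hy =>
      obtain ⟨ω, hω, rfl⟩ := hx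
      obtain ⟨ω', hω', rfl⟩ := hy
      refine ⟨ω ++ ω', fun i hi => ?_, cs.wordProd_append _ _⟩
      exact (List.mem_append.mp hi).elim (hω i) (hω' i)
    | inv x _ hx =>
      obtain ⟨ω, hω, rfl⟩ := hx
      exact ⟨ω.reverse, by simpa using hω, by simp⟩
  · rintro ⟨ω, hω, rfl⟩
    refine Subgroup.list_prod_mem _ fun x hx => ?_
    obtain ⟨i, hi, rfl⟩ := List.mem_map.mp hx
    exact Subgroup.subset_closure ⟨i, hω i hi, rfl⟩

/-- A minimal length element of a double coset `W_I a W_J` with `a ∈ W_K` lies in `W_K`. -/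
theorem mem_closure_of_minimal_double_coset {I J K : Set B} {u a v w : W}
    (hu : u ∈ Subgroup.closure (cs.simple '' I)) (ha : a ∈ Subgroup.closure (cs.simple '' K))
    (hv : v ∈ Subgroup.closure (cs.simple '' J)) (hw : w = u * a * v)
    (hmin : ∀ x ∈ Subgroup.closure (cs.simple '' I), ∀ y ∈ Subgroup.closure (cs.simple '' J),
      cs.length w ≤ cs.length (x * w * y)) :
    w ∈ Subgroup.closure (cs.simple '' K) := by
  obtain ⟨α, hα, rfl⟩ := cs.mem_closure_simple_image_iff.mp hu
  obtain ⟨β, hβ, rfl⟩ := cs.mem_closure_simple_image_iff.mp ha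
  obtain ⟨γ, hγ, rfl⟩ := cs.mem_closure_simple_image_iff.mp hv
  obtain ⟨ω, hsub, hred, hprod⟩ := cs.exists_isReduced_sublist (α ++ β ++ γ)
  rw [wordProd_append, wordProd_append, ← hw] at hprod
  obtain ⟨δ, γ', rfl, hδ, hγ'⟩ := List.sublist_append_iff.mp hsub
  obtain ⟨α', β', rfl, hα', hβ'⟩ := List.sublist_append_iff.mp hδ
  have hα'I := cs.mem_closure_simple_image_iff.mpr
    ⟨α', fun i hi => hα i (hα'.subset hi), rfl⟩
  have hγ'J := cs.mem_closure_simple_image_iff.mpr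
    ⟨γ', fun i hi => hγ i (hγ'.subset hi), rfl⟩
  have hle := hmin _ (inv_mem hα'I) _ (inv_mem hγ'J)
  have hβ'eq : (cs.wordProd α')⁻¹ * w * (cs.wordProd γ')⁻¹ = cs.wordProd β' := by
    rw [← hprod, wordProd_append, wordProd_append]
    group
  rw [IsReduced, hprod] at hred
  rw [hβ'eq, hred, List.length_append, List.length_append] at hle
  have hlen := cs.length_wordProd_le β'
  obtain rfl : α' = [] := List.length_eq_zero_iff.mp (by lia)
  obtain rfl : γ' = [] := List.length_eq_zero_iff.mp (by lia)
  refine cs.mem_closure_simple_image_iff.mpr ⟨β', fun i hi => hβ i (hβ'.subset hi), ?_⟩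
  simpa using hprod

end CoxeterSystem

namespace GRCSystem

variable {B R : Type*} [Monoid R] (G : GRCSystem B R)

theorem eq_of_conj_eq {E e f : R} (hE : IsIdempotentElem E) (he : e ∈ G.Λ) (hf : f ∈ G.Λ)
    {u v : Rˣ} (hu : (u : R) * e * ((u⁻¹ : Rˣ) : R) = E)
    (hv : (v : R) * f * ((v⁻¹ : Rˣ) : R) = E) : e = f :=
  (G.transversal E hE).unique ⟨he, u, hu⟩ ⟨hf, v, hv⟩

/-- An idempotent below `e ∈ Λ` is conjugate, by an element of `W(e)`, to some `h ≤ e` in `Λ`. -/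
theorem exists_conj_of_le {e E : R} (he : e ∈ G.Λ) (hE : IsIdempotentElem E)
    (h₁ : E * e = E) (h₂ : e * E = E) :
    ∃ v ∈ G.parab (G.lam e), ∃ h ∈ G.Λ, h * e = h ∧ e * h = h ∧
      (v : R) * h * ((v⁻¹ : Rˣ) : R) = E := by
  obtain ⟨v, h, f, hh, hf, hhf, hfh, hvh, hvf⟩ := G.ecs4 E e hE (G.lam_idem e he) h₁ h₂
  obtain rfl : f = e := G.eq_of_conj_eq (u := v) (v := 1) (G.lam_idem e he) hf he hvf (by simp)
  exact ⟨v, (G.mem_lam_iff f he v).mp (by rwa [← Units.mul_inv_eq_iff_eq_mul]),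
    h, hh, hhf, hfh, hvh⟩

/-- Comparable conjugate idempotents are equal. -/
theorem eq_of_le_of_conj {h E : R} (hh : h ∈ G.Λ) (hE : IsIdempotentElem E)
    (h₁ : h * E = h) (h₂ : E * h = h) {v : Rˣ} (hv : (v : R) * h * ((v⁻¹ : Rˣ) : R) = E) :
    E = h := by
  obtain ⟨z, f₁, f₂, hf₁, hf₂, -, -, hz₁, hz₂⟩ := G.ecs4 h E (G.lam_idem h hh) hE h₁ h₂
  obtain rfl : f₁ = h := G.eq_of_conj_eq (u := z) (v := 1) (G.lam_idem h hh) hf₁ hh hz₁ (by simp)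
  obtain rfl : f₂ = f₁ := G.eq_of_conj_eq hE hf₂ hh hz₂ hv
  rw [← hz₁, hz₂]

theorem commute_of_mem_parab_lamCostar {h : R} {b : Rˣ} (hb : b ∈ G.parab (G.lamCostar h)) :
    (b : R) * h = h * (b : R) := by
  induction hb using Subgroup.closure_induction with
  | mem x hx =>
    obtain ⟨s, hs, rfl⟩ := hx
    exact hs.1
  | one => simp
  | mul x y _ _ hx hy => rw [Units.val_mul, mul_assoc, hy, ← mul_assoc, hx, mul_assoc]
  | inv x _ hx => exact (Commute.units_inv_left (show Commute (x : R) h from hx)).eq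

/-- `W(h) = W_⋆(h) W_{λ^⋆(h)}`. -/
theorem exists_mul_of_commute {h : R} (hh : h ∈ G.Λ) {x : Rˣ} (hx : (x : R) * h = h * (x : R)) :
    ∃ a ∈ G.parab (G.lamStar h), ∃ b ∈ G.parab (G.lamCostar h), x = a * b := by
  suffices ∃ b ∈ G.parab (G.lamCostar h), (x : R) * h = (b : R) * h by
    obtain ⟨b, hb, hxb⟩ := this
    have hbh := G.commute_of_mem_parab_lamCostar hb
    have hbh' := G.commute_of_mem_parab_lamCostar (inv_mem hb)
    have hah : ((x * b⁻¹ : Rˣ) : R) * h = h := by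
      rw [Units.val_mul, mul_assoc, hbh', ← mul_assoc, hxb, hbh, mul_assoc, Units.mul_inv, mul_one]
    refine ⟨x * b⁻¹, (G.mem_lamStar_iff h hh _).mp ⟨hah, ?_⟩, b, hb, by group⟩
    rw [Units.val_mul, ← mul_assoc, ← hx, mul_assoc, ← hbh', ← mul_assoc, ← Units.val_mul, hah]
  obtain ⟨ω, hω, rfl⟩ := G.cs.mem_closure_simple_image_iff.mp ((G.mem_lam_iff h hh x).mp hx)
  clear hx
  induction ω with
  | nil => exact ⟨1, one_mem _, by simp⟩
  | cons s ω ih =>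
    obtain ⟨b, hb, hωb⟩ := ih fun i hi => hω i (List.mem_cons_of_mem _ hi)
    have hsh : (G.cs.simple s : R) * h = h * (G.cs.simple s : R) :=
      (G.mem_lam_iff h hh _).mpr (Subgroup.subset_closure ⟨s, hω s List.mem_cons_self, rfl⟩)
    have hbh := G.commute_of_mem_parab_lamCostar hb
    rw [CoxeterSystem.wordProd_cons, Units.val_mul, mul_assoc, hωb]
    by_cases hs : (G.cs.simple s : R) * h = h
    · exact ⟨b, hb, by rw [hbh, ← mul_assoc, hs]⟩
    · exact ⟨G.cs.simple s * b, mul_mem (Subgroup.subset_closure ⟨s, ⟨hsh, hs⟩, rfl⟩) hb,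
        by rw [Units.val_mul, mul_assoc]⟩

theorem parab_lamCostar_le_parab_lam {h e : R} (hh : h ∈ G.Λ) (he : e ∈ G.Λ) (hhe : h * e = h) :
    G.parab (G.lamCostar h) ≤ G.parab (G.lam e) := by
  refine (Subgroup.closure_le _).mpr ?_
  rintro _ ⟨s, hs, rfl⟩
  exact (G.mem_lam_iff e he _).mp (G.ecs6 h hh e he hhe s hs).1

theorem _root_.IsIdempotentElem.units_conj {e : R} (he : IsIdempotentElem e) (w : Rˣ) :
    IsIdempotentElem ((w : R) * e * ((w⁻¹ : Rˣ) : R)) := by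
  rw [IsIdempotentElem]
  simp only [mul_assoc, Units.inv_mul_cancel_left]
  rw [← mul_assoc e, he.eq]

end GRCSystem

/-- for `e, f ∈ Λ` and `w` a `(λ(e), λ(f))`-reduced element of the unit group,
there is `h ∈ Λ` with `h ≤ e·f` such that `e·w·f = h` and `w ∈ W_⋆(h)`, i.e. `wh = hw = h`. -/
theorem reduced_sandwich_is_idempotent
    {B R : Type*} [Monoid R] (G : GRCSystem B R)
    (e f : R) (he : e ∈ G.Λ) (hf : f ∈ G.Λ) (w : Rˣ)
    (hw : G.IsRed (G.lam e) (G.lam f) w) :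
    ∃ h ∈ G.Λ, h * (e * f) = h ∧ (e * f) * h = h ∧
      e * (w : R) * f = h ∧ (w : R) * h = h ∧ h * (w : R) = h := by
  have hei := G.lam_idem e he
  have hfi := G.lam_idem f hf
  set E : R := e * ((w : R) * f * ((w⁻¹ : Rˣ) : R)) with hE
  have hc := G.idem_mul_comm _ _ hei (hfi.units_conj w)
  have hEi : IsIdempotentElem E := hei.mul_of_commute hc (hfi.units_conj w)
  have heE : e * E = E := by rw [hE, ← mul_assoc, hei.eq]
  have hEe : E * e = E := by rw [G.idem_mul_comm _ _ hEi hei, heE]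
  set E' : R := ((w⁻¹ : Rˣ) : R) * E * (w : R) with hE'
  have hE'i : IsIdempotentElem E' := by simpa using hEi.units_conj w⁻¹
  have hE'f : E' * f = E' := by
    simp only [hE', hE, mul_assoc, Units.inv_mul, mul_one, hfi.eq]
  have hfE' : f * E' = E' := by rw [G.idem_mul_comm _ _ hfi hE'i, hE'f]
  have hwE' : (w : R) * E' * ((w⁻¹ : Rˣ) : R) = E := by simp [hE', mul_assoc]
  obtain ⟨v, hv, h, hh, hhe, heh, hvE⟩ := G.exists_conj_of_le he hEi hEe heE
  obtain ⟨u, hu, h', hh', hhf, hfh, huE⟩ := G.exists_conj_of_le hf hE'i hE'f hfE'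
  have hwuE : ((w * u : Rˣ) : R) * h' * (((w * u)⁻¹ : Rˣ) : R) = E := by
    rw [← hwE', ← huE]
    simp [mul_assoc]
  obtain rfl : h' = h := G.eq_of_conj_eq hEi hh' hh hwuE hvE
  have hx : ((v⁻¹ * (w * u) : Rˣ) : R) * h' = h' * ((v⁻¹ * (w * u) : Rˣ) : R) := by
    rw [← Units.mul_inv_eq_iff_eq_mul, mul_inv_rev, inv_inv]
    rw [← hvE] at hwuE
    calc _ = ((v⁻¹ : Rˣ) : R) * (((w * u : Rˣ) : R) * h' * (((w * u)⁻¹ : Rˣ) : R)) * (v : R) := by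
          simp only [Units.val_mul, mul_assoc]
      _ = h' := by rw [hwuE]; simp [mul_assoc]
  obtain ⟨a, ha, b, hb, hab⟩ := G.exists_mul_of_commute hh hx
  have hwK : w ∈ G.parab (G.lamStar h') :=
    G.cs.mem_closure_of_minimal_double_coset hv ha
      (mul_mem (G.parab_lamCostar_le_parab_lam hh hf hhf hb) (inv_mem hu))
      (by rw [mul_assoc v, ← mul_assoc a, ← hab]; group) hw
  obtain ⟨hwh, hhw⟩ := (G.mem_lamStar_iff h' hh w).mpr hwK
  have hwh' : ((w⁻¹ : Rˣ) : R) * h' = h' := by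
    rw [Units.inv_mul_eq_iff_eq_mul, hwh]
  have hEh : E * h' = h' := by
    simp only [hE, mul_assoc, hwh', hfh, hwh, heh]
  have hhE : h' * E = h' := by rw [G.idem_mul_comm _ _ (G.lam_idem h' hh) hEi, hEh]
  have hEq : E = h' := G.eq_of_le_of_conj hh hEi hhE hEh hvE
  refine ⟨h', hh, by rw [← mul_assoc, hhe, hhf], by rw [mul_assoc, hfh, heh], ?_, hwh, hhw⟩
  calc e * (w : R) * f = E * (w : R) := by simp [hE, mul_assoc]
    _ = h' := by rw [hEq, hhw]
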